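/- (Three-point inequality for the primal prox step with two prox terms, equation (5.11) in the paper.) Let n be a positive integer, 𝒳 ⊆ ℝⁿ a closed convex set, ν : ℝⁿ → ℝ convex and differentiable with Bregman divergence V(x̂,x) := ν(x) − ν(x̂) − ⟨∇ν(x̂), x − x̂⟩, μ ≥ 0, η > 0, p > 0, c ∈ ℝⁿ, and x', x̂ ∈ 𝒳. If x⁺ is a minimizer over 𝒳 of x ↦ μν(x) + ⟨c, x⟩ + η V(x', x) + p V(x̂, x), then for every x ∈ 𝒳: ⟨c, x⁺ − x⟩ + μν(x⁺) − μν(x) + η V(x', x⁺) + (μ + η + p) V(x⁺, x) + p V(x̂, x⁺) ≤ η V(x', x) + p V(x̂, x). -/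

import Mathlib

open scoped RealInnerProductSpace

noncomputable section

/-- (Three-point inequality for the primal prox step with two prox terms, equation (5.11).) -/
theorem primal_prox_three_point
    {n : ℕ} (hn : 0 < n)
    (X : Set (EuclideanSpace ℝ (Fin n))) (hXclosed : IsClosed X) (hXconv : Convex ℝ X)
    (ν : EuclideanSpace ℝ (Fin n) → ℝ)
    (hνconv : ConvexOn ℝ Set.univ ν) (hνdiff : Differentiable ℝ ν)
    (V : EuclideanSpace ℝ (Fin n) → EuclideanSpace ℝ (Fin n) → ℝ)
    (hV : ∀ a b, V a b = ν b - ν a - ⟪gradient ν a, b - a⟫)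
    (μ : ℝ) (hμ : 0 ≤ μ) (η : ℝ) (hη : 0 < η) (p : ℝ) (hp : 0 < p)
    (c : EuclideanSpace ℝ (Fin n))
    (x' : EuclideanSpace ℝ (Fin n)) (hx' : x' ∈ X)
    (xh : EuclideanSpace ℝ (Fin n)) (hxh : xh ∈ X)
    (xp : EuclideanSpace ℝ (Fin n)) (hxp : xp ∈ X)
    (hmin : IsMinOn (fun x => μ * ν x + ⟪c, x⟫ + η * V x' x + p * V xh x) X xp) :
    ∀ x ∈ X, ⟪c, xp - x⟫ + μ * ν xp - μ * ν x + η * V x' xp + (μ + η + p) * V xp x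
      + p * V xh xp ≤ η * V x' x + p * V xh x := by
  intro x hx
  have hν : HasFDerivAt ν (innerSL ℝ (gradient ν xp)) xp :=
    (hνdiff xp).hasGradientAt.hasFDerivAt
  have hlin : ∀ a : EuclideanSpace ℝ (Fin n), HasFDerivAt (fun y => ⟪a, y⟫) (innerSL ℝ a) xp :=
    fun a => (innerSL ℝ a).hasFDerivAt
  have hVderiv : ∀ a, HasFDerivAt (fun y => V a y)
      (innerSL ℝ (gradient ν xp) - innerSL ℝ (gradient ν a)) xp := by
    intro a
    have hVeq : (fun y => V a y) =
        fun y => ν y - ⟪gradient ν a, y⟫ - (ν a - ⟪gradient ν a, a⟫) := by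
      funext y
      rw [hV, inner_sub_right]
      ring
    rw [hVeq]
    exact (hν.sub (hlin _)).sub_const _
  have hderiv := (((hν.const_mul μ).add (hlin c)).add ((hVderiv x').const_mul η)).add
    ((hVderiv xh).const_mul p)
  have hopt := hmin.localize.hasFDerivWithinAt_nonneg hderiv.hasFDerivWithinAt
    (sub_mem_posTangentConeAt_of_segment_subset (hXconv.segment_subset hxp hx))
  simp only [add_apply, sub_apply,
    smul_apply, innerSL_apply_apply, smul_eq_mul, inner_sub_right] at hopt
  simp only [hV, inner_sub_right]
  linarith
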